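/- Szegő pushforward of the Gross–Witten measures: For g ∈ ℝ, the pushforward of GW(g) under the Szegő map e^{iθ} ↦ 2·cos θ equals: 𝒟(−2+4|g|⁻¹, −2) if g ≤ −1; |g|·𝒟(2,−2) + (1−|g|)·Arcsine if −1 ≤ g ≤ 0; g·𝒟(−2,2) + (1−g)·Arcsine if 0 ≤ g ≤ 1; and 𝒟(2−4g⁻¹, 2) if g ≥ 1. -/

import Mathlib

open MeasureTheory Real Filter Set Topology Polynomial
open scoped ENNReal ComplexConjugate

noncomputable section

namespace SumRules

-- Kullback–Leibler divergence `K(ν | μ)`.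
open Classical in
def KLdiv {α : Type*} [MeasurableSpace α] (ν μ : Measure α) : ℝ≥0∞ :=
  if ν ≪ μ ∧ Integrable (llr ν μ) ν then ENNReal.ofReal (∫ x, llr ν μ x ∂ν) else ⊤

/-- The (topological) support of a measure. -/
def suppSet {α : Type*} [TopologicalSpace α] [MeasurableSpace α] (μ : Measure α) : Set α :=
  {x | ∀ U ∈ nhds x, μ U ≠ 0}

/-- A measure is nontrivial if its support is infinite, i.e. it is not carried
by any finite set. -/
def InfiniteSupport {α : Type*} [MeasurableSpace α] (μ : Measure α) : Prop :=
  ∀ s : Finset α, μ (↑s : Set α)ᶜ ≠ 0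

/-- The set of support points outside `[cm, cp]`. -/
def ES (μ : Measure ℝ) (cm cp : ℝ) : Set ℝ := suppSet μ \ Icc cm cp

/-- `μ ∈ 𝒮₁(cm, cp)`: the support of `μ` is contained in `[cm, cp]` together with an
at most countable set of points outside this interval. -/
def InS1 (μ : Measure ℝ) (cm cp : ℝ) : Prop := (ES μ cm cp).Countable

/-- `a b` (indexed so that `a (k+1) = a_{k+1}`, `b (k+1) = b_{k+1}`, `k ≥ 0`) are the Jacobi
coefficients of `μ`: there is a sequence of orthonormal polynomials (with positive leading
coefficients, obtained by Gram-Schmidt from `1, x, x², …`) satisfying the three-term recursion. -/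
def IsJacobi (μ : Measure ℝ) (a b : ℕ → ℝ) : Prop :=
  (∀ k : ℕ, 0 < a (k+1)) ∧
  ∃ p : ℕ → Polynomial ℝ,
    (∀ k, (p k).natDegree = k) ∧ (∀ k, 0 < (p k).leadingCoeff) ∧
    (∀ j k, ∫ x, (p j).eval x * (p k).eval x ∂μ = if j = k then 1 else 0) ∧
    (∀ (k : ℕ) (x : ℝ), x * (p k).eval x =
      a (k+1) * (p (k+1)).eval x + b (k+1) * (p k).eval x +
        (if k = 0 then 0 else a k * (p (k-1)).eval x))

/-- `u` is the sequence of canonical moments of a measure on `[-2,2]` (with `u 0 = -1`). -/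
def IsCanonicalMoments (μ : Measure ℝ) (u : ℕ → ℝ) : Prop :=
  u 0 = -1 ∧ (∀ k : ℕ, u (k+1) ∈ Ioo (-1 : ℝ) 1) ∧
  ∃ a b : ℕ → ℝ, IsJacobi μ a b ∧
    (∀ k : ℕ, b (k+1) = (1 - u (2*k)) * u (2*k+1) - (1 + u (2*k)) * u (2*k-1)) ∧
    (∀ k : ℕ, (a (k+1))^2 = (1 - u (2*k)) * (1 - (u (2*k+1))^2) * (1 + u (2*k+2)))

/-- `z` is the sequence of canonical coefficients of a measure supported in `[0,∞)`. -/
def IsCanonicalZ (μ : Measure ℝ) (z : ℕ → ℝ) : Prop :=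
  z 0 = 0 ∧ (∀ k : ℕ, 0 ≤ z (k+1)) ∧
  ∃ a b : ℕ → ℝ, IsJacobi μ a b ∧
    (∀ k : ℕ, b (k+1) = z (2*k) + z (2*k+1)) ∧
    (∀ k : ℕ, (a (k+1))^2 = z (2*k+1) * z (2*k+2))

def Gfun (x : ℝ) : ℝ := x - 1 - Real.log x

/-- The semicircle law. -/
def SCm : Measure ℝ :=
  volume.withDensity fun x => ENNReal.ofReal (Real.sqrt (4 - x^2) / (2*π))

/-- The arcsine law on `(-2,2)`. -/
def ArcsineM : Measure ℝ :=
  volume.withDensity fun x => ENNReal.ofReal (1 / (π * Real.sqrt (4 - x^2)))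

/-- The measure with density `(2/(π|q-p|)) √((x-p)/(q-x))` between `p` and `q`. -/
def Dmeas (p q : ℝ) : Measure ℝ :=
  volume.withDensity fun x => ENNReal.ofReal (2/(π * |q - p|) * Real.sqrt ((x - p)/(q - x)))

/-- The point `e^{iθ}` on the unit circle. -/
def ctheta (θ : ℝ) : ℂ := Complex.exp (θ * Complex.I)

/-- Reversed polynomial `Φ*` with conjugated coefficients: `Φ*(z) = z^k conj(Φ(1/conj z))`. -/
def polyStar (P : Polynomial ℂ) : Polynomial ℂ := (P.map (starRingEnd ℂ)).reverse

/-- `α` is the sequence of Verblunsky coefficients of the measure `ν` on the unit circle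
(`ν` being given in angle coordinates, carried by `[0, 2π)`): the monic orthogonal
polynomials of `ν` satisfy the Szegő recursion with coefficients `α`. -/
def IsVerblunsky (ν : Measure ℝ) (α : ℕ → ℂ) : Prop :=
  (∀ k, ‖α k‖ < 1) ∧
  ∃ Φ : ℕ → Polynomial ℂ,
    (∀ k, (Φ k).Monic) ∧ (∀ k, (Φ k).natDegree = k) ∧
    (∀ j k, j ≠ k →
      ∫ θ, conj ((Φ j).eval (ctheta θ)) * (Φ k).eval (ctheta θ) ∂ν = 0) ∧
    (∀ k, Φ (k+1) = Polynomial.X * Φ k - Polynomial.C (conj (α k)) * polyStar (Φ k))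

/-- `γ` is the sequence of deformed Verblunsky coefficients of `ν`. -/
def IsDeformedVerblunsky (ν : Measure ℝ) (γ : ℕ → ℂ) : Prop :=
  ∃ α : ℕ → ℂ, IsVerblunsky ν α ∧
    ∀ k : ℕ, γ k = conj (α k) * ∏ j ∈ Finset.range k, (1 - conj (γ j)) / (1 - γ j)

/-- Symmetry of a measure on the circle (in angle coordinates): invariance under conjugation. -/
def SymmCircle (ν : Measure ℝ) : Prop :=
  (ν.map ctheta).map (starRingEnd ℂ) = ν.map ctheta

/-- The uniform measure on the circle, in angle coordinates. -/
def UNIFm : Measure ℝ :=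
  volume.withDensity fun θ => ENNReal.ofReal (if 0 ≤ θ ∧ θ < 2*π then 1/(2*π) else 0)

end SumRules

namespace SumRules

/-- Outlier contribution for the Killip–Simon sum rule (`+∞` inside `(-2,2)`). -/
def FSC (x : ℝ) : ℝ≥0∞ :=
  if 2 ≤ |x| then
    ENNReal.ofReal (|x|/2 * Real.sqrt (x^2 - 4) - 2 * Real.log ((|x| + Real.sqrt (x^2 - 4))/2))
  else ⊤

/-- Coefficient side of the Killip–Simon sum rule. -/
def IH (a b : ℕ → ℝ) : ℝ≥0∞ :=
  (1/2 : ℝ≥0∞) * ∑' k : ℕ, ENNReal.ofReal ((b (k+1))^2)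
    + ∑' k : ℕ, ENNReal.ofReal (Gfun ((a (k+1))^2))

def tauM (τ : ℝ) : ℝ := (1 - Real.sqrt τ)^2
def tauP (τ : ℝ) : ℝ := (1 + Real.sqrt τ)^2

/-- The Marchenko–Pastur law with parameter `τ`. -/
def MPm (τ : ℝ) : Measure ℝ :=
  volume.withDensity fun x =>
    ENNReal.ofReal (Real.sqrt ((x - tauM τ) * (tauP τ - x)) / (2*π*τ*x))

/-- Outlier contribution for the Marchenko–Pastur sum rule. -/
def FMP (τ : ℝ) (x : ℝ) : ℝ≥0∞ :=
  if tauP τ ≤ x then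
    ENNReal.ofReal (∫ t in (tauP τ)..x, Real.sqrt ((t - tauP τ) * (t - tauM τ)) / (τ*t))
  else if 0 < x ∧ x ≤ tauM τ then
    ENNReal.ofReal (∫ t in x..(tauM τ), Real.sqrt ((t - tauP τ) * (t - tauM τ)) / (τ*t))
  else ⊤

/-- Coefficient side of the Marchenko–Pastur sum rule. -/
def IL (τ : ℝ) (z : ℕ → ℝ) : ℝ≥0∞ :=
  ∑' k : ℕ, ENNReal.ofReal (τ⁻¹ * Gfun (z (2*k+1)) + Gfun (τ⁻¹ * z (2*k+2)))

def uPl (κ₁ κ₂ : ℝ) : ℝ :=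
  2*(κ₂^2 - κ₁^2 + 4*Real.sqrt ((1+κ₁)*(1+κ₂)*(1+κ₁+κ₂)))/(2+κ₁+κ₂)^2
def uMi (κ₁ κ₂ : ℝ) : ℝ :=
  2*(κ₂^2 - κ₁^2 - 4*Real.sqrt ((1+κ₁)*(1+κ₂)*(1+κ₁+κ₂)))/(2+κ₁+κ₂)^2

/-- The Kesten–McKay law with parameters `κ₁, κ₂`. -/
def KMKm (κ₁ κ₂ : ℝ) : Measure ℝ :=
  volume.withDensity fun x =>
    ENNReal.ofReal ((2+κ₁+κ₂)/(2*π) * Real.sqrt ((x - uMi κ₁ κ₂) * (uPl κ₁ κ₂ - x)) / (4 - x^2))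

def ue (κ₁ κ₂ : ℝ) : ℝ := -(κ₁+κ₂)/(2+κ₁+κ₂)
def uo (κ₁ κ₂ : ℝ) : ℝ := (κ₂-κ₁)/(2+κ₁+κ₂)

def He (κ₁ κ₂ u : ℝ) : ℝ :=
  -(1+κ₁+κ₂) * Real.log ((1-u)/(1 - ue κ₁ κ₂)) - Real.log ((1+u)/(1 + ue κ₁ κ₂))
def Ho (κ₁ κ₂ u : ℝ) : ℝ :=
  -(1+κ₁) * Real.log ((1-u)/(1 - uo κ₁ κ₂)) - (1+κ₂) * Real.log ((1+u)/(1 + uo κ₁ κ₂))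

/-- Coefficient side of the Kesten–McKay sum rule. -/
def IJ (κ₁ κ₂ : ℝ) (u : ℕ → ℝ) : ℝ≥0∞ :=
  ∑' k : ℕ, (ENNReal.ofReal (Ho κ₁ κ₂ (u (2*k+1))) + ENNReal.ofReal (He κ₁ κ₂ (u (2*k+2))))

/-- Outlier contribution for the Kesten–McKay sum rule. -/
def FKMK (κ₁ κ₂ : ℝ) (x : ℝ) : ℝ≥0∞ :=
  if uPl κ₁ κ₂ ≤ x then
    ENNReal.ofReal (∫ t in (uPl κ₁ κ₂)..x,
      (2+κ₁+κ₂) * Real.sqrt ((t - uPl κ₁ κ₂) * (t - uMi κ₁ κ₂)) / (4 - t^2))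
  else if x ≤ uMi κ₁ κ₂ then
    ENNReal.ofReal (∫ t in x..(uMi κ₁ κ₂),
      (2+κ₁+κ₂) * Real.sqrt ((t - uPl κ₁ κ₂) * (t - uMi κ₁ κ₂)) / (4 - t^2))
  else ⊤

def Hgw (g : ℝ) : ℝ := 1 - Real.sqrt (1 - g^2) + Real.log ((1 + Real.sqrt (1 - g^2))/2)

def thetaG (g : ℝ) : ℝ := 2 * Real.arcsin (Real.sqrt (1/|g|))

/-- The Gross–Witten measures, in angle coordinates. -/
def GWm (g : ℝ) : Measure ℝ :=
  if |g| ≤ 1 then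
    volume.withDensity fun θ =>
      ENNReal.ofReal (if 0 ≤ θ ∧ θ < 2*π then (1 + g * Real.cos θ)/(2*π) else 0)
  else if g < -1 then
    volume.withDensity fun θ => ENNReal.ofReal (
      if π - thetaG g ≤ θ ∧ θ ≤ π + thetaG g then
        |g| / π * Real.sin (θ/2) * Real.sqrt (Real.sin (θ/2)^2 - Real.cos (thetaG g/2)^2)
      else 0)
  else
    volume.withDensity fun θ => ENNReal.ofReal (
      if -thetaG g ≤ θ ∧ θ ≤ thetaG g then
        g/π * Real.cos (θ/2) * Real.sqrt (Real.sin (thetaG g/2)^2 - Real.sin (θ/2)^2)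
      else 0)

def thetaD (d : ℝ) : ℝ := 2 * Real.arcsin (d/(1+d))
def gammaD (d : ℝ) : ℝ := -d/(1+d)

/-- The Hua–Pickrell measure, in angle coordinates. -/
def HPm (d : ℝ) : Measure ℝ :=
  volume.withDensity fun θ => ENNReal.ofReal (
    if thetaD d < θ ∧ θ < 2*π - thetaD d then
      (1+d) * Real.sqrt (Real.sin (θ/2)^2 - Real.sin (thetaD d/2)^2) / (2*π*Real.sin (θ/2))
    else 0)

/-- The entropy-like function appearing in the Hua–Pickrell sum rule. -/
def HHP (d : ℝ) (γ : ℂ) : ℝ :=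
  -Real.log ((1 - ‖γ‖^2)/(1 - (gammaD d)^2)) - 2*d*Real.log (‖1 - γ‖/(1 - gammaD d))

/-- Outlier contribution for the Hua–Pickrell sum rule (in angle coordinates). -/
def FHP (d : ℝ) (θ : ℝ) : ℝ≥0∞ :=
  if θ ≤ thetaD d then
    ENNReal.ofReal (∫ φ in θ..(thetaD d),
      (1+d) * Real.sqrt (Real.sin (thetaD d/2)^2 - Real.sin (φ/2)^2) / Real.sin (φ/2))
  else if 2*π - thetaD d ≤ θ then
    ENNReal.ofReal (∫ φ in (2*π - thetaD d)..θ,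
      (1+d) * Real.sqrt (Real.sin (thetaD d/2)^2 - Real.sin (φ/2)^2) / Real.sin (φ/2))
  else ⊤

/-- Set of outlying support points for a measure on the circle, in angle coordinates. -/
def EST (ν : Measure ℝ) (tm tp : ℝ) : Set ℝ := suppSet ν \ Icc tm tp

/-- `ν ∈ 𝒮₁^𝕋(tm, tp)` (in angle coordinates). -/
def InS1T (ν : Measure ℝ) (tm tp : ℝ) : Prop := (EST ν tm tp).Countable

/-- The measure `𝒟(2,-2)`, with density `(1/2π)√((2-x)/(2+x))` on `(-2,2)`
(a shift of the hard-edge Marchenko–Pastur law). -/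
def Dhard : Measure ℝ :=
  volume.withDensity fun x => ENNReal.ofReal (Real.sqrt ((2 - x)/(2 + x)) / (2*π))

/-- The mixture `μ_g = |g| 𝒟(2,-2) + (1-|g|) Arcsine`. -/
def mugMix (g : ℝ) : Measure ℝ :=
  ENNReal.ofReal |g| • Dhard + ENNReal.ofReal (1 - |g|) • ArcsineM

/-- The mixture `ρ_g = |g| SC + (1-|g|) Arcsine`. -/
def rhog (g : ℝ) : Measure ℝ :=
  ENNReal.ofReal |g| • SCm + ENNReal.ofReal (1 - |g|) • ArcsineM

def Cg (g : ℝ) : ℝ :=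
  -|g| * (1 - Real.log 2) + 1 - Real.sqrt (1 - g^2) + Real.log ((1 + Real.sqrt (1 - g^2))/2)

/-- The measure with density `(1/2π)(2+x)^{3/2}(2-x)^{1/2}` on `[-2,2]`. -/
def muHat : Measure ℝ :=
  volume.withDensity fun x =>
    ENNReal.ofReal ((2 + x) * Real.sqrt (2 + x) * Real.sqrt (2 - x) / (2*π))

/-- The Poisson kernel measure `Pois(ζ)`, in angle coordinates. -/
def PoisM (ζ : ℂ) : Measure ℝ :=
  volume.withDensity fun θ => ENNReal.ofReal (
    if 0 ≤ θ ∧ θ < 2*π then (1 - ‖ζ‖^2)/(2*π*‖ctheta θ - ζ‖^2) else 0)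

/-- The Carathéodory function of a measure on the circle (angle coordinates). -/
def Cara (ν : Measure ℝ) (z : ℂ) : ℂ := ∫ θ, (ctheta θ + z)/(ctheta θ - z) ∂ν

/-- `f` is the Schur function of `ν`. -/
def IsSchurFn (ν : Measure ℝ) (f : ℂ → ℂ) : Prop :=
  DifferentiableOn ℂ f (Metric.ball 0 1) ∧
  (∀ z ∈ Metric.ball (0:ℂ) 1, ‖f z‖ ≤ 1) ∧
  (∀ z ∈ Metric.ball (0:ℂ) 1, Cara ν z - 1 = z * f z * (Cara ν z + 1))

/-- Möbius transform of the unit disk. -/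
def mtrans (ρ z : ℂ) : ℂ := (z - ρ)/(1 - conj ρ * z)

def npRaw (ρ : ℂ) (g : ℂ → ℂ) (z : ℂ) : ℂ :=
  ((-ρ/(‖ρ‖ : ℂ)) / mtrans ρ z) * ((g z - g ρ)/(1 - conj (g ρ) * g z))

-- One step of the Nevanlinna–Pick algorithm at `ρ` (the removable singularity at `ρ`
-- is filled in by the limit).
open Classical in
def npStep (ρ : ℂ) (g : ℂ → ℂ) : ℂ → ℂ := fun z =>
  if z = ρ then limUnder (𝓝[≠] ρ) (npRaw ρ g) else npRaw ρ g z

def schurRaw (g : ℂ → ℂ) (z : ℂ) : ℂ := ((g z - g 0)/z)/(1 - conj (g 0) * g z)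

-- One step of the classical Schur algorithm (the removable singularity at `0`
-- is filled in by the limit).
open Classical in
def schurStep (g : ℂ → ℂ) : ℂ → ℂ := fun z =>
  if z = 0 then limUnder (𝓝[≠] (0:ℂ)) (schurRaw g) else schurRaw g z

def xdHP (d : ℝ) : ℝ := 2*(1 + 2*d - d^2)/(1+d)^2

def uKMK (d : ℝ) : ℝ := 2*Real.sqrt (1 + 2*d)/(1+d)

end SumRules

namespace SumRules

lemma push_aux (c : ℝ) (hc : c = 0 ∨ c = 2 * π) (d h : ℝ → ℝ≥0∞) (hd : Measurable d)
    (hh : Measurable h)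
    (hd0 : ∀ θ, θ ∉ Ioo 0 π → θ ∉ Ioo (c - π) c → θ ∉ ({0, c, π, c - π} : Set ℝ) → d θ = 0)
    (hsym : ∀ θ ∈ Ioo 0 π, d (c - θ) = d θ)
    (hh0 : ∀ x, x ∉ Ioo (-2 : ℝ) 2 → h x = 0)
    (hmain : ∀ θ ∈ Ioo 0 π, 2 * d θ = ENNReal.ofReal (2 * Real.sin θ) * h (2 * Real.cos θ)) :
    (volume.withDensity d).map (fun θ => 2 * Real.cos θ) = volume.withDensity h := by
  have hm : Measurable (fun θ : ℝ => 2 * Real.cos θ) := by fun_prop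
  have hcos : ∀ θ, Real.cos (c - θ) = Real.cos θ := by
    intro θ
    rcases hc with rfl | rfl
    · simp
    · exact Real.cos_two_pi_sub θ
  have hpi := Real.pi_pos
  have himg : (fun θ : ℝ => 2 * Real.cos θ) '' Ioo 0 π = Ioo (-2) 2 := by
    ext x
    constructor
    · rintro ⟨θ, hθ, rfl⟩
      have h1 := Real.strictAntiOn_cos (⟨le_rfl, hpi.le⟩) (⟨hθ.1.le, hθ.2.le⟩) hθ.1
      have h2 := Real.strictAntiOn_cos (⟨hθ.1.le, hθ.2.le⟩) (⟨hpi.le, le_rfl⟩) hθ.2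
      rw [Real.cos_zero] at h1
      rw [Real.cos_pi] at h2
      constructor <;> simp only <;> linarith
    · rintro ⟨h1, h2⟩
      refine ⟨Real.arccos (x / 2), ⟨Real.arccos_pos.2 (by linarith), ?_⟩, ?_⟩
      · refine lt_of_le_of_ne (Real.arccos_le_pi _) ?_
        intro h
        rw [Real.arccos_eq_pi] at h
        linarith
      · simp only
        rw [Real.cos_arccos (by linarith) (by linarith)]; ring
  ext S hS
  rw [Measure.map_apply hm hS, withDensity_apply _ (hm hS), withDensity_apply _ hS]
  rw [← lintegral_indicator (hm hS), ← lintegral_indicator hS]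
  set F : ℝ → ℝ≥0∞ := ((fun θ : ℝ => 2 * Real.cos θ) ⁻¹' S).indicator d with hF
  have hFm : Measurable F := hd.indicator (hm hS)
  have hFsym : ∀ θ ∈ Ioo 0 π, F (c - θ) = F θ := by
    intro θ hθ
    have hc' := hcos θ
    by_cases h2 : 2 * Real.cos θ ∈ S
    · simp [hF, Set.indicator, hc', h2, hsym θ hθ]
    · simp [hF, Set.indicator, hc', h2]
  have hF0 : ∀ᵐ θ, θ ∉ Ioo 0 π ∪ Ioo (c - π) c → F θ = 0 := by
    have : ∀ᵐ θ : ℝ, θ ∉ ({0, c, π, c - π} : Set ℝ) := by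
      rw [← compl_compl ({0, c, π, c - π} : Set ℝ)]
      refine (Set.Countable.ae_notMem ?_ _)
      simp
    filter_upwards [this] with θ h1 h2
    rw [mem_union, not_or] at h2
    simp [hF, Set.indicator, hd0 θ h2.1 h2.2 h1]
  have hA : ∫⁻ θ, F θ = ∫⁻ θ in Ioo 0 π ∪ Ioo (c - π) c, F θ := by
    rw [← lintegral_indicator (measurableSet_Ioo.union measurableSet_Ioo)]
    refine lintegral_congr_ae ?_
    filter_upwards [hF0] with θ h
    by_cases h2 : θ ∈ Ioo 0 π ∪ Ioo (c - π) c
    · simp [Set.indicator, h2]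
    · rw [h h2, Set.indicator_of_notMem h2]
  have hdisj : Disjoint (Ioo 0 π) (Ioo (c - π) c) := by
    rw [Set.disjoint_left]
    rintro θ ⟨h1, h2⟩ ⟨h3, h4⟩
    rcases hc with rfl | rfl <;> linarith
  have hB : ∫⁻ θ in Ioo (c - π) c, F θ = ∫⁻ θ in Ioo 0 π, F θ := by
    rw [← lintegral_indicator measurableSet_Ioo, ← lintegral_indicator measurableSet_Ioo,
      ← lintegral_sub_left_eq_self _ c]
    congr 1
    ext θ
    by_cases h2 : θ ∈ Ioo 0 π
    · rw [Set.indicator_of_mem h2, Set.indicator_of_mem, hFsym θ h2]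
      constructor <;> linarith [h2.1, h2.2]
    · rw [Set.indicator_of_notMem h2, Set.indicator_of_notMem]
      rintro ⟨h3, h4⟩
      exact h2 ⟨by linarith, by linarith⟩
  have hR : ∫⁻ x, S.indicator h x = ∫⁻ x in Ioo (-2 : ℝ) 2, S.indicator h x := by
    rw [← lintegral_indicator measurableSet_Ioo]
    congr 1
    ext x
    by_cases h2 : x ∈ Ioo (-2 : ℝ) 2
    · rw [Set.indicator_of_mem h2]
    · rw [Set.indicator_of_notMem h2]
      simp [Set.indicator, hh0 x h2]
  have hinj : InjOn (fun θ : ℝ => 2 * Real.cos θ) (Ioo 0 π) := by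
    intro a ha b hb hab
    exact Real.injOn_cos ⟨ha.1.le, ha.2.le⟩ ⟨hb.1.le, hb.2.le⟩ (by simpa using hab)
  rw [hA, lintegral_union measurableSet_Ioo hdisj, hB, hR, ← himg,
    lintegral_image_eq_lintegral_abs_deriv_mul (f' := fun θ => 2 * (- Real.sin θ))
      measurableSet_Ioo
      (fun θ _ => ((Real.hasDerivAt_cos θ).const_mul 2).hasDerivWithinAt) hinj,
    ← two_mul, ← lintegral_const_mul _ hFm]
  refine setLIntegral_congr_fun measurableSet_Ioo ?_
  intro θ hθ
  have hs := Real.sin_pos_of_pos_of_lt_pi hθ.1 hθ.2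
  have : |2 * (-Real.sin θ)| = 2 * Real.sin θ := by
    rw [abs_of_neg (by linarith)]; ring
  simp only [this, hF]
  by_cases h2 : 2 * Real.cos θ ∈ S
  · simp only [Set.indicator, mem_preimage, h2, if_true]
    exact hmain θ hθ
  · simp [Set.indicator, h2]

lemma half_facts {θ : ℝ} (hθ : θ ∈ Ioo 0 π) :
    0 < Real.sin (θ/2) ∧ 0 < Real.cos (θ/2) ∧ Real.sin θ = 2 * Real.sin (θ/2) * Real.cos (θ/2) ∧
    Real.cos θ = 1 - 2 * Real.sin (θ/2)^2 ∧ Real.cos θ = 2 * Real.cos (θ/2)^2 - 1 := by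
  have hc : Real.cos θ = 2 * Real.cos (θ/2)^2 - 1 := by
    rw [← Real.cos_two_mul]; congr 1; ring
  refine ⟨Real.sin_pos_of_pos_of_lt_pi (by linarith [hθ.1]) (by linarith [hθ.1, hθ.2]),
    Real.cos_pos_of_mem_Ioo ⟨by linarith [hθ.1, hθ.2], by linarith [hθ.2]⟩, ?_, ?_, hc⟩
  · rw [← Real.sin_two_mul]; congr 1; ring
  · have := Real.sin_sq_add_cos_sq (θ/2)
    linarith

lemma two_ofReal_aux (a b e : ℝ) (hb : 0 ≤ b) (h : 2 * a = b * e) :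
    2 * ENNReal.ofReal a = ENNReal.ofReal b * ENNReal.ofReal e := by
  rw [← ENNReal.ofReal_mul hb, ← h, ENNReal.ofReal_mul (by norm_num)]
  simp

lemma mix_pos (g : ℝ) (h0 : 0 ≤ g) (h1 : g ≤ 1) : (GWm g).map (fun θ => 2 * Real.cos θ) =
      ENNReal.ofReal g • Dmeas (-2) 2 + ENNReal.ofReal (1 - g) • ArcsineM := by
  have hpi := Real.pi_pos
  rw [GWm, if_pos (abs_le.2 ⟨by linarith, h1⟩), Dmeas, ArcsineM,
    ← withDensity_smul _ (by fun_prop), ← withDensity_smul _ (by fun_prop),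
    ← withDensity_add_left (by fun_prop)]
  have e : ∀ x : ℝ, (ENNReal.ofReal g • (fun x : ℝ => ENNReal.ofReal
      (2/(π * |2 - (-2)|) * Real.sqrt ((x - (-2))/(2 - x)))) + ENNReal.ofReal (1 - g) •
      (fun x : ℝ => ENNReal.ofReal (1 / (π * Real.sqrt (4 - x^2))))) x =
      ENNReal.ofReal (g * (1/(2*π) * Real.sqrt ((x+2)/(2-x))) +
        (1-g) * (1 / (π * Real.sqrt (4 - x^2)))) := by
    intro x
    have hg : 0 ≤ 1 - g := by linarith
    rw [ENNReal.ofReal_add (by positivity) (by positivity), ENNReal.ofReal_mul h0,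
      ENNReal.ofReal_mul hg]
    simp only [Pi.add_apply, Pi.smul_apply, smul_eq_mul]
    have : 2/(π * |2 - (-2:ℝ)|) = 1/(2*π) := by
      rw [abs_of_pos (by norm_num)]; field_simp; norm_num
    rw [this, sub_neg_eq_add]
  rw [funext e]
  refine push_aux (2*π) (Or.inr rfl) _ _ ?_ (by fun_prop) ?_ ?_ ?_ ?_
  · refine ENNReal.measurable_ofReal.comp (Measurable.ite ?_ (by fun_prop) (by fun_prop))
    exact measurableSet_Ico
  · intro θ hA hB hC
    rw [if_neg]; · simp
    rintro ⟨h2, h3⟩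
    simp only [mem_Ioo, mem_insert_iff, mem_singleton_iff, not_and, not_or, not_lt] at hA hB hC
    rcases lt_or_ge θ π with h | h
    · exact absurd (hA (lt_of_le_of_ne h2 (Ne.symm hC.1))) (not_le.2 h)
    · exact absurd (hB (by have := lt_of_le_of_ne h (Ne.symm hC.2.2.1); linarith)) (not_le.2 h3)
  · intro θ hθ
    rw [if_pos ⟨by linarith [hθ.2], by linarith [hθ.1]⟩,
      if_pos ⟨hθ.1.le, by linarith [hθ.2]⟩, Real.cos_two_pi_sub]
  · intro x hx
    rw [Real.sqrt_eq_zero_of_nonpos, Real.sqrt_eq_zero_of_nonpos]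
    · simp
    · by_contra! h
      exact hx ⟨by nlinarith, by nlinarith⟩
    · rcases le_or_gt x (-2) with h | h
      · exact div_nonpos_of_nonpos_of_nonneg (by linarith) (by linarith)
      · have : 2 ≤ x := by by_contra! h3; exact hx ⟨h, h3⟩
        exact div_nonpos_of_nonneg_of_nonpos (by linarith) (by linarith)
  · intro θ hθ
    rw [if_pos ⟨hθ.1.le, by linarith [hθ.2]⟩]
    obtain ⟨hs, hk, hsin, hc1, hc2⟩ := half_facts hθ
    have hsp := Real.sin_pos_of_pos_of_lt_pi hθ.1 hθ.2
    refine two_ofReal_aux _ _ _ (by linarith) ?_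
    have r1 : Real.sqrt ((2 * Real.cos θ + 2)/(2 - 2 * Real.cos θ)) =
        Real.cos (θ/2) / Real.sin (θ/2) := by
      rw [Real.sqrt_eq_iff_mul_self_eq_of_pos (by positivity)]
      have : (2 - 2 * Real.cos θ) = 4 * Real.sin (θ/2)^2 := by rw [hc1]; ring
      have h' : (2 * Real.cos θ + 2) = 4 * Real.cos (θ/2)^2 := by rw [hc2]; ring
      rw [this, h']; field_simp
    have r2 : Real.sqrt (4 - (2 * Real.cos θ)^2) = 2 * Real.sin θ := by
      rw [Real.sqrt_eq_iff_mul_self_eq_of_pos (by positivity)]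
      nlinarith [Real.sin_sq_add_cos_sq θ]
    rw [r1, r2]
    have : 2 * Real.sin θ * (g * (1/(2*π) * (Real.cos (θ/2) / Real.sin (θ/2))) +
        (1-g) * (1 / (π * (2 * Real.sin θ)))) = g * (2 * Real.cos (θ/2)^2) / π + (1 - g)/π := by
      rw [hsin]; field_simp; try ring
    rw [this, hc2]; field_simp; ring

lemma mix_neg (g : ℝ) (h1 : -1 ≤ g) (h0 : g ≤ 0) : (GWm g).map (fun θ => 2 * Real.cos θ) =
      ENNReal.ofReal |g| • Dmeas 2 (-2) + ENNReal.ofReal (1 - |g|) • ArcsineM := by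
  have hpi := Real.pi_pos
  have hag : |g| = -g := abs_of_nonpos h0
  rw [GWm, if_pos (abs_le.2 ⟨by linarith, by linarith⟩), Dmeas, ArcsineM,
    ← withDensity_smul _ (by fun_prop), ← withDensity_smul _ (by fun_prop),
    ← withDensity_add_left (by fun_prop), hag]
  have e : ∀ x : ℝ, (ENNReal.ofReal (-g) • (fun x : ℝ => ENNReal.ofReal
      (2/(π * |-2 - 2|) * Real.sqrt ((x - 2)/(-2 - x)))) + ENNReal.ofReal (1 - -g) •
      (fun x : ℝ => ENNReal.ofReal (1 / (π * Real.sqrt (4 - x^2))))) x =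
      ENNReal.ofReal ((-g) * (1/(2*π) * Real.sqrt ((x-2)/(-2-x))) +
        (1- -g) * (1 / (π * Real.sqrt (4 - x^2)))) := by
    intro x
    have hg : 0 ≤ 1 - -g := by linarith
    have hg' : 0 ≤ -g := by linarith
    rw [ENNReal.ofReal_add (by positivity) (by positivity), ENNReal.ofReal_mul hg',
      ENNReal.ofReal_mul hg]
    simp only [Pi.add_apply, Pi.smul_apply, smul_eq_mul]
    have : 2/(π * |-2 - (2:ℝ)|) = 1/(2*π) := by
      rw [abs_of_neg (by norm_num)]; field_simp; norm_num
    rw [this]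
  rw [funext e]
  refine push_aux (2*π) (Or.inr rfl) _ _ ?_ (by fun_prop) ?_ ?_ ?_ ?_
  · refine ENNReal.measurable_ofReal.comp (Measurable.ite ?_ (by fun_prop) (by fun_prop))
    exact measurableSet_Ico
  · intro θ hA hB hC
    rw [if_neg]; · simp
    rintro ⟨h2, h3⟩
    simp only [mem_Ioo, mem_insert_iff, mem_singleton_iff, not_and, not_or, not_lt] at hA hB hC
    rcases lt_or_ge θ π with h | h
    · exact absurd (hA (lt_of_le_of_ne h2 (Ne.symm hC.1))) (not_le.2 h)
    · exact absurd (hB (by have := lt_of_le_of_ne h (Ne.symm hC.2.2.1); linarith)) (not_le.2 h3)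
  · intro θ hθ
    rw [if_pos ⟨by linarith [hθ.2], by linarith [hθ.1]⟩,
      if_pos ⟨hθ.1.le, by linarith [hθ.2]⟩, Real.cos_two_pi_sub]
  · intro x hx
    rw [Real.sqrt_eq_zero_of_nonpos, Real.sqrt_eq_zero_of_nonpos]
    · simp
    · by_contra! h
      exact hx ⟨by nlinarith, by nlinarith⟩
    · rcases le_or_gt x (-2) with h | h
      · exact div_nonpos_of_nonpos_of_nonneg (by linarith) (by linarith)
      · have : 2 ≤ x := by by_contra! h3; exact hx ⟨h, h3⟩
        exact div_nonpos_of_nonneg_of_nonpos (by linarith) (by linarith)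
  · intro θ hθ
    rw [if_pos ⟨hθ.1.le, by linarith [hθ.2]⟩]
    obtain ⟨hs, hk, hsin, hc1, hc2⟩ := half_facts hθ
    have hsp := Real.sin_pos_of_pos_of_lt_pi hθ.1 hθ.2
    refine two_ofReal_aux _ _ _ (by linarith) ?_
    have r1 : Real.sqrt ((2 * Real.cos θ - 2)/(-2 - 2 * Real.cos θ)) =
        Real.sin (θ/2) / Real.cos (θ/2) := by
      rw [Real.sqrt_eq_iff_mul_self_eq_of_pos (by positivity)]
      have : (2 * Real.cos θ - 2) = -(4 * Real.sin (θ/2)^2) := by rw [hc1]; ring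
      have h' : (-2 - 2 * Real.cos θ) = -(4 * Real.cos (θ/2)^2) := by rw [hc2]; ring
      rw [this, h', neg_div_neg_eq]; field_simp
    have r2 : Real.sqrt (4 - (2 * Real.cos θ)^2) = 2 * Real.sin θ := by
      rw [Real.sqrt_eq_iff_mul_self_eq_of_pos (by positivity)]
      nlinarith [Real.sin_sq_add_cos_sq θ]
    rw [r1, r2]
    have : 2 * Real.sin θ * ((-g) * (1/(2*π) * (Real.sin (θ/2) / Real.cos (θ/2))) +
        (1- -g) * (1 / (π * (2 * Real.sin θ)))) = (-g) * (2 * Real.sin (θ/2)^2) / π + (1 - -g)/π := by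
      rw [hsin]; field_simp; try ring
    rw [this, hc1]; field_simp; ring

lemma thetaG_facts {a g : ℝ} (ha : |g| = a) (h : 1 < a) :
    Real.sin (thetaG g / 2)^2 = 1/a ∧ Real.cos (thetaG g / 2)^2 = 1 - 1/a ∧
    0 ≤ thetaG g ∧ thetaG g ≤ π ∧
    ∀ t, 0 ≤ t → t ≤ π → ¬ (t ≤ thetaG g) → 1/a ≤ Real.sin (t/2)^2 := by
  have ha0 : 0 < a := by linarith
  have hr0 : 0 ≤ Real.sqrt (1/a) := Real.sqrt_nonneg _
  have hr1 : Real.sqrt (1/a) ≤ 1 := by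
    rw [Real.sqrt_le_iff, one_pow, div_le_one ha0]; exact ⟨zero_le_one, h.le⟩
  have hT : thetaG g / 2 = Real.arcsin (Real.sqrt (1/a)) := by
    rw [thetaG, ha]; ring
  have hsq : Real.sin (thetaG g / 2)^2 = 1/a := by
    rw [hT, Real.sin_arcsin (by linarith) hr1, Real.sq_sqrt (by positivity)]
  have hn : 0 ≤ thetaG g / 2 := by rw [hT]; exact Real.arcsin_nonneg.2 hr0
  have hle : thetaG g / 2 ≤ π / 2 := by rw [hT]; exact Real.arcsin_le_pi_div_two _
  refine ⟨hsq, ?_, by linarith, by linarith, ?_⟩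
  · have := Real.sin_sq_add_cos_sq (thetaG g / 2)
    linarith
  · intro t h0 h1 h2
    rw [← hsq]
    push Not at h2
    refine pow_le_pow_left₀ (Real.sin_nonneg_of_nonneg_of_le_pi hn (by linarith)) ?_ 2
    exact Real.sin_le_sin_of_le_of_le_pi_div_two (by linarith) (by linarith) (by linarith)

lemma big_pos (g : ℝ) (h : 1 < g) :
    (GWm g).map (fun θ => 2 * Real.cos θ) = Dmeas (2 - 4/g) 2 := by
  have hpi := Real.pi_pos
  have hg : 0 < g := by linarith
  have hag : |g| = g := abs_of_pos hg
  obtain ⟨hS, hC, hT0, hT1, hT⟩ := thetaG_facts hag h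
  have h1g : 1/g < 1 := by rw [div_lt_one hg]; exact h
  have h0g : 0 < 1/g := by positivity
  have h4 : 4/g = 4 * (1/g) := by ring
  rw [GWm, if_neg (by rw [hag]; linarith), if_neg (by linarith), Dmeas, hS]
  refine push_aux 0 (Or.inl rfl) _ _ ?_ (by fun_prop) ?_ ?_ ?_ ?_
  · refine ENNReal.measurable_ofReal.comp (Measurable.ite ?_ (by fun_prop) (by fun_prop))
    exact measurableSet_Icc
  · intro θ hA hB hC
    rw [if_neg]; · simp
    rintro ⟨h2, h3⟩
    simp only [mem_Ioo, mem_insert_iff, mem_singleton_iff, not_and, not_or, not_lt] at hA hB hC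
    rcases lt_or_gt_of_ne hC.1 with h | h
    · refine absurd (hB (lt_of_le_of_ne (by linarith) (Ne.symm hC.2.2.2))) (not_le.2 h)
    · exact absurd (lt_of_le_of_ne (hA h) (Ne.symm hC.2.2.1)) (not_lt.2 (by linarith))
  · intro θ hθ
    have e1 : (0 - θ)/2 = -(θ/2) := by ring
    have e2 : (-thetaG g ≤ 0 - θ ∧ 0 - θ ≤ thetaG g) ↔ (-thetaG g ≤ θ ∧ θ ≤ thetaG g) := by
      constructor <;> rintro ⟨_, _⟩ <;> constructor <;> linarith
    simp only [e1, e2, Real.cos_neg, Real.sin_neg, neg_sq]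
  · intro x hx
    rw [Real.sqrt_eq_zero_of_nonpos]
    · simp
    · rcases le_or_gt x (-2) with h | h
      · exact div_nonpos_of_nonpos_of_nonneg (by linarith) (by linarith)
      · have : 2 ≤ x := by by_contra! h3; exact hx ⟨h, h3⟩
        exact div_nonpos_of_nonneg_of_nonpos (by linarith) (by linarith)
  · intro θ hθ
    obtain ⟨hs, hk, hsin, hc1, hc2⟩ := half_facts hθ
    have hsp := Real.sin_pos_of_pos_of_lt_pi hθ.1 hθ.2
    refine two_ofReal_aux _ _ _ (by linarith) ?_
    have r1 : Real.sqrt ((2 * Real.cos θ - (2 - 4/g))/(2 - 2 * Real.cos θ)) =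
        Real.sqrt (1/g - Real.sin (θ/2)^2) / Real.sin (θ/2) := by
      have : (2 * Real.cos θ - (2 - 4/g))/(2 - 2 * Real.cos θ) =
          (1/g - Real.sin (θ/2)^2) / Real.sin (θ/2)^2 := by
        rw [hc1]; field_simp; ring
      rw [this, Real.sqrt_div' _ (by positivity), Real.sqrt_sq hs.le]
    have r2 : (if -thetaG g ≤ θ ∧ θ ≤ thetaG g then
        g/π * Real.cos (θ/2) * Real.sqrt (1/g - Real.sin (θ/2)^2) else 0) =
        g/π * Real.cos (θ/2) * Real.sqrt (1/g - Real.sin (θ/2)^2) := by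
      split_ifs with hif
      · rfl
      · rw [Real.sqrt_eq_zero_of_nonpos, mul_zero]
        have := hT θ hθ.1.le hθ.2.le (fun h' => hif ⟨by linarith [hθ.1], h'⟩)
        linarith
    have r3 : |2 - (2 - 4/g)| = 4/g := by
      rw [sub_sub_cancel, abs_of_pos (by positivity)]
    rw [r1, r2, r3, hsin]
    field_simp; try ring

lemma big_neg (g : ℝ) (h : g < -1) :
    (GWm g).map (fun θ => 2 * Real.cos θ) = Dmeas (-2 + 4/|g|) (-2) := by
  have hpi := Real.pi_pos
  obtain ⟨a, hag⟩ : ∃ a, |g| = a := ⟨_, rfl⟩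
  have ha1 : 1 < a := by rw [← hag, abs_of_neg (by linarith)]; linarith
  have hg : 0 < a := by linarith
  obtain ⟨hS, hC, hT0, hT1, hT⟩ := thetaG_facts hag ha1
  have h1g : 1/a < 1 := by rw [div_lt_one hg]; exact ha1
  have h0g : 0 < 1/a := by positivity
  have h4 : 4/a = 4 * (1/a) := by ring
  rw [GWm, if_neg (by rw [hag]; linarith), if_pos (by linarith), Dmeas, hC, hag]
  refine push_aux (2*π) (Or.inr rfl) _ _ ?_ (by fun_prop) ?_ ?_ ?_ ?_
  · refine ENNReal.measurable_ofReal.comp (Measurable.ite ?_ (by fun_prop) (by fun_prop))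
    exact measurableSet_Icc
  · intro θ hA hB hC
    rw [if_neg]; · simp
    rintro ⟨h2, h3⟩
    simp only [mem_Ioo, mem_insert_iff, mem_singleton_iff, not_and, not_or, not_lt] at hA hB hC
    rcases lt_or_gt_of_ne hC.2.2.1 with h | h
    · exact absurd (hA (lt_of_le_of_ne (by linarith) (Ne.symm hC.1))) (not_le.2 h)
    · exact absurd (lt_of_le_of_ne (hB (by linarith)) (Ne.symm hC.2.1)) (not_lt.2 (by linarith))
  · intro θ hθ
    have e1 : (2*π - θ)/2 = π - (θ/2) := by ring
    have e2 : (π - thetaG g ≤ 2*π - θ ∧ 2*π - θ ≤ π + thetaG g) ↔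
        (π - thetaG g ≤ θ ∧ θ ≤ π + thetaG g) := by
      constructor <;> rintro ⟨_, _⟩ <;> constructor <;> linarith
    simp only [e1, e2, Real.sin_pi_sub]
  · intro x hx
    rw [Real.sqrt_eq_zero_of_nonpos]
    · simp
    · rcases le_or_gt x (-2) with h | h
      · exact div_nonpos_of_nonpos_of_nonneg (by linarith) (by linarith)
      · have : 2 ≤ x := by by_contra! h3; exact hx ⟨h, h3⟩
        exact div_nonpos_of_nonneg_of_nonpos (by linarith) (by linarith)
  · intro θ hθ
    obtain ⟨hs, hk, hsin, hc1, hc2⟩ := half_facts hθ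
    have hsp := Real.sin_pos_of_pos_of_lt_pi hθ.1 hθ.2
    have hsc := Real.sin_sq_add_cos_sq (θ/2)
    refine two_ofReal_aux _ _ _ (by linarith) ?_
    have r1 : Real.sqrt ((2 * Real.cos θ - (-2 + 4/a))/(-2 - 2 * Real.cos θ)) =
        Real.sqrt (1/a - Real.cos (θ/2)^2) / Real.cos (θ/2) := by
      have : (2 * Real.cos θ - (-2 + 4/a))/(-2 - 2 * Real.cos θ) =
          (1/a - Real.cos (θ/2)^2) / Real.cos (θ/2)^2 := by
        have n1 : 2 * Real.cos θ - (-2 + 4/a) = (-4) * (1/a - Real.cos (θ/2)^2) := by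
          rw [hc2]; ring
        have n2 : -2 - 2 * Real.cos θ = (-4) * Real.cos (θ/2)^2 := by rw [hc2]; ring
        rw [n1, n2, mul_div_mul_left _ _ (by norm_num)]
      rw [this, Real.sqrt_div' _ (by positivity), Real.sqrt_sq hk.le]
    have r0 : Real.sin (θ/2)^2 - (1 - 1/a) = 1/a - Real.cos (θ/2)^2 := by linarith
    rw [r0]
    have r2 : (if π - thetaG g ≤ θ ∧ θ ≤ π + thetaG g then
        a/π * Real.sin (θ/2) * Real.sqrt (1/a - Real.cos (θ/2)^2) else 0) =
        a/π * Real.sin (θ/2) * Real.sqrt (1/a - Real.cos (θ/2)^2) := by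
      split_ifs with hif
      · rfl
      · rw [Real.sqrt_eq_zero_of_nonpos, mul_zero]
        have := hT (π - θ) (by linarith [hθ.2]) (by linarith [hθ.1])
          (fun h' => hif ⟨by linarith, by linarith [hθ.2]⟩)
        have e : (π - θ)/2 = π/2 - θ/2 := by ring
        rw [e, Real.sin_pi_div_two_sub] at this
        linarith
    have r3 : |-2 - (-2 + 4/a)| = 4/a := by
      rw [sub_add_cancel_left, abs_neg, abs_of_pos (by positivity)]
    rw [r1, r2, r3, hsin]
    field_simp; try ring

/-- Szegő pushforward of the Gross–Witten measures. -/
theorem szego_pushforward_GW (g : ℝ) :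
    (g ≤ -1 → (GWm g).map (fun θ => 2 * Real.cos θ) = Dmeas (-2 + 4/|g|) (-2)) ∧
    (-1 ≤ g → g ≤ 0 → (GWm g).map (fun θ => 2 * Real.cos θ) =
      ENNReal.ofReal |g| • Dmeas 2 (-2) + ENNReal.ofReal (1 - |g|) • ArcsineM) ∧
    (0 ≤ g → g ≤ 1 → (GWm g).map (fun θ => 2 * Real.cos θ) =
      ENNReal.ofReal g • Dmeas (-2) 2 + ENNReal.ofReal (1 - g) • ArcsineM) ∧
    (1 ≤ g → (GWm g).map (fun θ => 2 * Real.cos θ) = Dmeas (2 - 4/g) 2) := by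
  refine ⟨fun h => ?_, mix_neg g, mix_pos g, fun h => ?_⟩
  · rcases h.lt_or_eq with h | rfl
    · exact big_neg g h
    · rw [mix_neg (-1) le_rfl (by norm_num)]
      norm_num
  · rcases h.lt_or_eq with h | rfl
    · exact big_pos g h
    · rw [mix_pos 1 (by norm_num) le_rfl]
      norm_num

end SumRules
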